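/- Fix a linear order on V. Suppose f : Finset V → ℝ satisfies f(∅) = 0 and, for every nonempty C ⊆ V, f(C) equals the maximum, over all feasible coalitions C' ⊆ C that contain the minimum element of C, of v(C') plus the sum, over the connected components D of the subgraph of G induced on C \ C', of f(D). Then f(C) = OPT(C) for every C ⊆ V; in particular, f(V) is the value of an optimal coalition structure of the G-restricted coalition structure generation problem. (This is the value-level content of the paper's Theorem 1, the correctness of DyPE's hierarchical dynamic program.) -/

import Mathlib

/-- A coalition `C` is feasible in the synergy graph `G` if it is nonempty and the
subgraph of `G` induced on `C` is connected. -/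
def Feasible {V : Type*} (G : SimpleGraph V) (C : Finset V) : Prop :=
  C.Nonempty ∧ (G.induce (C : Set V)).Connected

/-- `π` is a partition of `C` into feasible coalitions. -/
def IsFeasiblePartition {V : Type*} [DecidableEq V] (G : SimpleGraph V)
    (π : Finset (Finset V)) (C : Finset V) : Prop :=
  (∀ D ∈ π, Feasible G D) ∧ (π : Set (Finset V)).PairwiseDisjoint id ∧ π.biUnion id = C

/-- `OPT G v C` is the maximum, over all partitions of `C` into feasible coalitions,
of the sum of `v` over the parts (with `OPT G v ∅ = 0`, via the empty partition). -/
noncomputable def OPT {V : Type*} [DecidableEq V] (G : SimpleGraph V)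
    (v : Finset V → ℝ) (C : Finset V) : ℝ :=
  sSup {x : ℝ | ∃ π : Finset (Finset V), IsFeasiblePartition G π C ∧ x = ∑ D ∈ π, v D}

open Classical in
/-- The connected components of the subgraph of `G` induced on `C`, i.e. the maximal
feasible subsets of `C`. -/
noncomputable def comps {V : Type*} [DecidableEq V] (G : SimpleGraph V)
    (C : Finset V) : Finset (Finset V) :=
  C.powerset.filter fun D => Feasible G D ∧
    ∀ D' ∈ C.powerset, D ⊆ D' → Feasible G D' → D' = D


theorem feasible_union {V : Type*} [DecidableEq V] {G : SimpleGraph V} {A B : Finset V}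
    (hA : Feasible G A) (hB : Feasible G B) {x : V} (hxA : x ∈ A) (hxB : x ∈ B) :
    Feasible G (A ∪ B) := by
  refine ⟨hA.1.mono Finset.subset_union_left, ?_⟩
  rw [Finset.coe_union]
  exact SimpleGraph.induce_union_connected hA.2.preconnected hB.2.preconnected ⟨x, hxA, hxB⟩

theorem feasible_singleton {V : Type*} (G : SimpleGraph V) (x : V) : Feasible G {x} := by
  refine ⟨Finset.singleton_nonempty x, ?_⟩
  rw [Finset.coe_singleton]
  have : Nonempty (({x} : Set V)) := ⟨⟨x, rfl⟩⟩
  refine ⟨?_⟩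
  intro a b
  rw [Subsingleton.elim a b]

theorem mem_comps {V : Type*} [DecidableEq V] {G : SimpleGraph V} {C D : Finset V} :
    D ∈ comps G C ↔ D ⊆ C ∧ Feasible G D ∧
      ∀ D' ⊆ C, D ⊆ D' → Feasible G D' → D' = D := by
  simp [comps]

theorem exists_comp {V : Type*} [DecidableEq V] {G : SimpleGraph V} {C D : Finset V}
    (hDC : D ⊆ C) (hD : Feasible G D) : ∃ E ∈ comps G C, D ⊆ E := by
  classical
  obtain ⟨E, hE, hmax⟩ := Finset.exists_max_image
    (C.powerset.filter fun E => D ⊆ E ∧ Feasible G E) Finset.card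
    ⟨D, by simp [hDC, hD]⟩
  simp only [Finset.mem_filter, Finset.mem_powerset] at hE hmax
  refine ⟨E, mem_comps.2 ⟨hE.1, hE.2.2, fun D' h1 h2 h3 => ?_⟩, hE.2.1⟩
  exact (Finset.eq_of_subset_of_card_le h2 (hmax D' ⟨h1, hE.2.1.trans h2, h3⟩)).symm

theorem comps_unique {V : Type*} [DecidableEq V] {G : SimpleGraph V} {C D E : Finset V}
    (hD : D ∈ comps G C) (hE : E ∈ comps G C) {x : V} (hxD : x ∈ D) (hxE : x ∈ E) :
    D = E := by
  rw [mem_comps] at hD hE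
  have hu := feasible_union hD.2.1 hE.2.1 hxD hxE
  have hs := Finset.union_subset hD.1 hE.1
  rw [← hD.2.2 _ hs Finset.subset_union_left hu]
  exact hE.2.2 _ hs Finset.subset_union_right hu

theorem exists_part {V : Type*} [DecidableEq V] {G : SimpleGraph V} (C : Finset V) :
    ∃ π, IsFeasiblePartition G π C := by
  refine ⟨comps G C, fun D hD => (mem_comps.1 hD).2.1, ?_, ?_⟩
  · intro D hD E hE hne
    refine Finset.disjoint_left.2 fun x hx hx' => hne (comps_unique hD hE hx hx')
  · ext x
    simp only [Finset.mem_biUnion, id]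
    constructor
    · rintro ⟨D, hD, hx⟩
      exact (mem_comps.1 hD).1 hx
    · intro hx
      obtain ⟨E, hE, h⟩ := exists_comp (Finset.singleton_subset_iff.2 hx) (feasible_singleton G x)
      exact ⟨E, hE, h (Finset.mem_singleton_self x)⟩

theorem finite_vals {V : Type*} [Fintype V] [DecidableEq V] (G : SimpleGraph V)
    (v : Finset V → ℝ) (C : Finset V) :
    {x : ℝ | ∃ π : Finset (Finset V), IsFeasiblePartition G π C ∧ x = ∑ D ∈ π, v D}.Finite := by
  refine (Set.finite_range (fun π : Finset (Finset V) => ∑ D ∈ π, v D)).subset ?_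
  rintro x ⟨π, -, rfl⟩
  exact ⟨π, rfl⟩

theorem le_OPT {V : Type*} [Fintype V] [DecidableEq V] {G : SimpleGraph V}
    (v : Finset V → ℝ) {C : Finset V} {π : Finset (Finset V)} (h : IsFeasiblePartition G π C) :
    ∑ D ∈ π, v D ≤ OPT G v C :=
  le_csSup (finite_vals G v C).bddAbove ⟨π, h, rfl⟩

theorem exists_OPT {V : Type*} [Fintype V] [DecidableEq V] (G : SimpleGraph V)
    (v : Finset V → ℝ) (C : Finset V) :
    ∃ π, IsFeasiblePartition G π C ∧ OPT G v C = ∑ D ∈ π, v D := by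
  obtain ⟨π, h⟩ := exists_part (G := G) C
  have hne : {x : ℝ | ∃ π : Finset (Finset V), IsFeasiblePartition G π C ∧
      x = ∑ D ∈ π, v D}.Nonempty := ⟨_, π, h, rfl⟩
  exact hne.csSup_mem (finite_vals G v C)

theorem part_subset {V : Type*} [DecidableEq V] {G : SimpleGraph V} {C D : Finset V}
    {π : Finset (Finset V)} (h : IsFeasiblePartition G π C) (hD : D ∈ π) : D ⊆ C := by
  rw [← h.2.2]
  exact Finset.subset_biUnion_of_mem id hD

theorem part_mem {V : Type*} [DecidableEq V] {G : SimpleGraph V} {C : Finset V}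
    {π : Finset (Finset V)} (h : IsFeasiblePartition G π C) {x : V} (hx : x ∈ C) :
    ∃ D ∈ π, x ∈ D := by
  rw [← h.2.2] at hx
  simpa using hx

theorem part_unique {V : Type*} [DecidableEq V] {G : SimpleGraph V} {C D E : Finset V}
    {π : Finset (Finset V)} (h : IsFeasiblePartition G π C) (hD : D ∈ π) (hE : E ∈ π)
    {x : V} (hxD : x ∈ D) (hxE : x ∈ E) : D = E := by
  by_contra hne
  exact Finset.disjoint_left.1 (h.2.1 hD hE hne) hxD hxE

theorem part_mk {V : Type*} [DecidableEq V] {G : SimpleGraph V} {C : Finset V}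
    {π : Finset (Finset V)} (h1 : ∀ D ∈ π, Feasible G D) (h2 : ∀ D ∈ π, D ⊆ C)
    (h3 : ∀ x ∈ C, ∃ D ∈ π, x ∈ D)
    (h4 : ∀ D ∈ π, ∀ E ∈ π, ∀ x, x ∈ D → x ∈ E → D = E) : IsFeasiblePartition G π C := by
  refine ⟨h1, ?_, ?_⟩
  · intro D hD E hE hne
    exact Finset.disjoint_left.2 fun x hx hx' => hne (h4 D hD E hE x hx hx')
  · ext x
    simp only [Finset.mem_biUnion, id]
    exact ⟨fun ⟨D, hD, hx⟩ => h2 D hD hx, h3 x⟩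

theorem OPT_comps {V : Type*} [Fintype V] [DecidableEq V] (G : SimpleGraph V)
    (v : Finset V → ℝ) (C : Finset V) : ∑ D ∈ comps G C, OPT G v D = OPT G v C := by
  classical
  apply le_antisymm
  · choose p hp hpo using exists_OPT G v
    have hdisj : ∀ D ∈ comps G C, ∀ E ∈ comps G C, ∀ A, A ∈ p D → A ∈ p E → D = E := by
      intro D hD E hE A hA hA'
      obtain ⟨x, hx⟩ := ((hp D).1 A hA).1
      exact comps_unique hD hE (part_subset (hp D) hA hx) (part_subset (hp E) hA' hx)
    have hpart : IsFeasiblePartition G ((comps G C).biUnion p) C := by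
      apply part_mk
      · intro A hA
        obtain ⟨D, hD, hA⟩ := Finset.mem_biUnion.1 hA
        exact (hp D).1 A hA
      · intro A hA
        obtain ⟨D, hD, hA⟩ := Finset.mem_biUnion.1 hA
        exact (part_subset (hp D) hA).trans (mem_comps.1 hD).1
      · intro x hx
        obtain ⟨E, hE, h⟩ := exists_comp (Finset.singleton_subset_iff.2 hx)
          (feasible_singleton G x)
        obtain ⟨A, hA, hxA⟩ := part_mem (hp E) (h (Finset.mem_singleton_self x))
        exact ⟨A, Finset.mem_biUnion.2 ⟨E, hE, hA⟩, hxA⟩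
      · intro A hA B hB x hxA hxB
        obtain ⟨D, hD, hA⟩ := Finset.mem_biUnion.1 hA
        obtain ⟨E, hE, hB⟩ := Finset.mem_biUnion.1 hB
        obtain rfl := comps_unique hD hE (part_subset (hp D) hA hxA) (part_subset (hp E) hB hxB)
        exact part_unique (hp D) hA hB hxA hxB
    have := le_OPT v hpart
    rw [Finset.sum_biUnion] at this
    · simpa only [hpo] using this
    · intro D hD E hE hne
      exact Finset.disjoint_left.2 fun A hA hA' => hne (hdisj D hD E hE A hA hA')
  · obtain ⟨π, hπ, ho⟩ := exists_OPT G v C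
    have key : π = (comps G C).biUnion fun D => π.filter (· ⊆ D) := by
      ext A
      simp only [Finset.mem_biUnion, Finset.mem_filter]
      constructor
      · intro hA
        obtain ⟨E, hE, h⟩ := exists_comp (part_subset hπ hA) (hπ.1 A hA)
        exact ⟨E, hE, hA, h⟩
      · rintro ⟨_, _, hA, _⟩
        exact hA
    rw [ho, key, Finset.sum_biUnion]
    · refine Finset.sum_le_sum fun D hD => le_OPT v ?_
      apply part_mk
      · intro A hA
        exact hπ.1 A (Finset.mem_filter.1 hA).1
      · intro A hA
        exact (Finset.mem_filter.1 hA).2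
      · intro x hx
        obtain ⟨A, hA, hxA⟩ := part_mem hπ ((mem_comps.1 hD).1 hx)
        obtain ⟨E, hE, h⟩ := exists_comp (part_subset hπ hA) (hπ.1 A hA)
        obtain rfl := comps_unique hD hE hx (h hxA)
        exact ⟨A, Finset.mem_filter.2 ⟨hA, h⟩, hxA⟩
      · intro A hA B hB x hxA hxB
        exact part_unique hπ (Finset.mem_filter.1 hA).1 (Finset.mem_filter.1 hB).1 hxA hxB
    · intro D hD E hE hne
      refine Finset.disjoint_left.2 fun A hA hA' => hne ?_
      rw [Finset.mem_filter] at hA hA'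
      obtain ⟨x, hx⟩ := (hπ.1 A hA.1).1
      exact comps_unique hD hE (hA.2 hx) (hA'.2 hx)

theorem OPT_empty {V : Type*} [Fintype V] [DecidableEq V] (G : SimpleGraph V)
    (v : Finset V → ℝ) : OPT G v ∅ = 0 := by
  obtain ⟨π, hπ, ho⟩ := exists_OPT G v ∅
  rw [ho]
  refine Finset.sum_eq_zero fun D hD => ?_
  obtain ⟨x, hx⟩ := (hπ.1 D hD).1
  exact absurd (part_subset hπ hD hx) (Finset.notMem_empty x)

theorem dype_correctness {V : Type*} [Fintype V] [DecidableEq V] [LinearOrder V]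
    (G : SimpleGraph V) (v : Finset V → ℝ) (f : Finset V → ℝ)
    (hf0 : f ∅ = 0)
    (hf : ∀ (C : Finset V) (hC : C.Nonempty),
      f C = sSup {x : ℝ | ∃ C' : Finset V, C' ⊆ C ∧ C.min' hC ∈ C' ∧ Feasible G C' ∧
        x = v C' + ∑ D ∈ comps G (C \ C'), f D}) :
    (∀ C : Finset V, f C = OPT G v C) ∧ f Finset.univ = OPT G v Finset.univ := by
  suffices h : ∀ C : Finset V, f C = OPT G v C from ⟨h, h _⟩
  rename_i i1 i2 i3
  obtain rfl : i2 = i3.toDecidableEq := Subsingleton.elim _ _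
  intro C
  induction C using Finset.strongInduction with
  | H C ih =>
  rcases C.eq_empty_or_nonempty with rfl | hC
  · rw [hf0, OPT_empty]
  have hrec : ∀ C', C' ⊆ C → C.min' hC ∈ C' →
      ∑ D ∈ comps G (C \ C'), f D = OPT G v (C \ C') := by
    intro C' hC' hm
    rw [← OPT_comps]
    refine Finset.sum_congr rfl fun D hD => ih D ?_
    have hs := (mem_comps.1 hD).1
    refine (Finset.ssubset_iff_of_subset (hs.trans Finset.sdiff_subset)).2
      ⟨C.min' hC, C.min'_mem hC, fun h => (Finset.mem_sdiff.1 (hs h)).2 hm⟩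
  have hfin : {x : ℝ | ∃ C' : Finset V, C' ⊆ C ∧ C.min' hC ∈ C' ∧ Feasible G C' ∧
        x = v C' + ∑ D ∈ comps G (C \ C'), f D}.Finite := by
    refine (Set.finite_range
      (fun C' : Finset V => v C' + ∑ D ∈ comps G (C \ C'), f D)).subset ?_
    rintro x ⟨C', -, -, -, rfl⟩
    exact ⟨C', rfl⟩
  rw [hf C hC]
  apply le_antisymm
  · refine csSup_le ⟨_, {C.min' hC}, Finset.singleton_subset_iff.2 (C.min'_mem hC),
      Finset.mem_singleton_self _, feasible_singleton G _, rfl⟩ ?_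
    rintro x ⟨C', hs, hm, hfe, rfl⟩
    rw [hrec C' hs hm]
    obtain ⟨π, hπ, ho⟩ := exists_OPT G v (C \ C')
    have hout : ∀ D ∈ π, ∀ x ∈ D, x ∉ C' := fun D hD x hx =>
      (Finset.mem_sdiff.1 (part_subset hπ hD hx)).2
    have hnot : C' ∉ π := fun h => hout C' h _ hm hm
    rw [ho, ← Finset.sum_insert hnot]
    apply le_OPT
    apply part_mk
    · intro D hD
      rcases Finset.mem_insert.1 hD with rfl | hD
      · exact hfe
      · exact hπ.1 D hD
    · intro D hD
      rcases Finset.mem_insert.1 hD with rfl | hD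
      · exact hs
      · exact (part_subset hπ hD).trans Finset.sdiff_subset
    · intro x hx
      by_cases hx' : x ∈ C'
      · exact ⟨C', Finset.mem_insert_self _ _, hx'⟩
      · obtain ⟨D, hD, hxD⟩ := part_mem hπ (Finset.mem_sdiff.2 ⟨hx, hx'⟩)
        exact ⟨D, Finset.mem_insert_of_mem hD, hxD⟩
    · intro D hD E hE x hxD hxE
      rcases Finset.mem_insert.1 hD with h1 | h1 <;> rcases Finset.mem_insert.1 hE with h2 | h2
      · rw [h1, h2]
      · exact absurd (h1 ▸ hxD) (hout E h2 x hxE)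
      · exact absurd (h2 ▸ hxE) (hout D h1 x hxD)
      · exact part_unique hπ h1 h2 hxD hxE
  · obtain ⟨π, hπ, ho⟩ := exists_OPT G v C
    obtain ⟨C', hC', hm⟩ := part_mem hπ (C.min'_mem hC)
    refine le_trans ?_ (le_csSup hfin.bddAbove
      ⟨C', part_subset hπ hC', hm, hπ.1 C' hC', rfl⟩)
    rw [hrec C' (part_subset hπ hC') hm, ho, ← Finset.add_sum_erase π v hC']
    refine add_le_add le_rfl (le_OPT v ?_)
    apply part_mk
    · intro D hD
      exact hπ.1 D (Finset.mem_of_mem_erase hD)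
    · intro D hD x hx
      refine Finset.mem_sdiff.2 ⟨part_subset hπ (Finset.mem_of_mem_erase hD) hx, fun hx' => ?_⟩
      exact Finset.ne_of_mem_erase hD (part_unique hπ (Finset.mem_of_mem_erase hD) hC' hx hx')
    · intro x hx
      rw [Finset.mem_sdiff] at hx
      obtain ⟨D, hD, hxD⟩ := part_mem hπ hx.1
      refine ⟨D, Finset.mem_erase.2 ⟨?_, hD⟩, hxD⟩
      rintro rfl
      exact hx.2 hxD
    · intro D hD E hE x hxD hxE
      exact part_unique hπ (Finset.mem_of_mem_erase hD) (Finset.mem_of_mem_erase hE) hxD hxE
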